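/- Let d ≥ 1 and ε, δ ∈ (0,1). If Ñ is a δ-net for B̃_{ε,d} with |Ñ| ≥ 3, then Ñ(ε, d) ≤ 3 ln|Ñ| / ((1−δ) ε). -/

import Mathlib

open MeasureTheory Set

noncomputable section

/-- The unit cube `Q_d = [0,1]^d`. -/
def cube (d : ℕ) : Set (Fin d → ℝ) := Set.univ.pi fun _ => Set.Icc (0 : ℝ) 1

/-- The periodic interval `I(s,t)`: `(s,t)` if `s < t`, and `[0,1] \ [t,s]` if `t < s`. -/
def perInterval (s t : ℝ) : Set ℝ :=
  if s < t then Set.Ioo s t else Set.Icc 0 1 \ Set.Icc t s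

/-- `B` is a periodic axis-parallel box in the unit cube. -/
def IsPerBox {d : ℕ} (B : Set (Fin d → ℝ)) : Prop :=
  ∃ a b : Fin d → ℝ, a ∈ cube d ∧ b ∈ cube d ∧ (∀ i, a i ≠ b i) ∧
    B = Set.univ.pi fun i => perInterval (a i) (b i)

/-- Periodic dispersion of a point set `P ⊆ Q_d`. -/
def pdisp {d : ℕ} (P : Set (Fin d → ℝ)) : ℝ :=
  sSup {v : ℝ | ∃ B : Set (Fin d → ℝ), IsPerBox B ∧ B ∩ P = ∅ ∧ v = (volume B).toReal}

/-- Minimal periodic dispersion `disp̃*(n,d)`. -/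
def pminDisp (n d : ℕ) : ℝ :=
  sInf {v : ℝ | ∃ P : Finset (Fin d → ℝ),
    ↑P ⊆ cube d ∧ P.card = n ∧ v = pdisp (↑P : Set (Fin d → ℝ))}

/-- Inverse of the minimal periodic dispersion, `Ñ(ε,d)`. -/
def pNinv (ε : ℝ) (d : ℕ) : ℕ := sInf {n : ℕ | pminDisp n d ≤ ε}

/-- `F` is a `δ`-net for the family `B̃_{ε,d}` of periodic boxes of volume at least `ε`. -/
def IsPerDeltaNet (δ ε : ℝ) (d : ℕ) (F : Finset (Set (Fin d → ℝ))) : Prop :=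
  (∀ B ∈ F, IsPerBox B) ∧
  ∀ B : Set (Fin d → ℝ), IsPerBox B → ε ≤ (volume B).toReal →
    ∃ B₀ ∈ F, B₀ ⊆ B ∧ (1 - δ) * (volume B).toReal ≤ (volume B₀).toReal

lemma perInterval_meas (s t : ℝ) : MeasurableSet (perInterval s t) := by
  unfold perInterval
  split_ifs
  · exact measurableSet_Ioo
  · exact measurableSet_Icc.diff measurableSet_Icc

lemma IsPerBox.meas {d : ℕ} {B : Set (Fin d → ℝ)} (h : IsPerBox B) : MeasurableSet B := by
  obtain ⟨a, b, -, -, -, rfl⟩ := h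
  exact MeasurableSet.univ_pi fun i => perInterval_meas _ _

lemma IsPerBox.sub {d : ℕ} {B : Set (Fin d → ℝ)} (h : IsPerBox B) : B ⊆ cube d := by
  obtain ⟨a, b, ha, hb, -, rfl⟩ := h
  intro x hx i hi
  have h1 := hx i hi
  have h2 := ha i hi
  have h3 := hb i hi
  simp only [perInterval] at h1
  split_ifs at h1
  · exact ⟨h2.1.trans h1.1.le, h1.2.le.trans h3.2⟩
  · exact h1.1

lemma volume_cube (d : ℕ) : volume (cube d) = 1 := by
  rw [cube, volume_pi_pi]; simp

open Classical in
lemma exists_pt {d : ℕ} (p : ℝ) (G : Finset (Set (Fin d → ℝ)))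
    (hG : ∀ B ∈ G, IsPerBox B ∧ p ≤ (volume B).toReal) :
    ∃ x ∈ cube d, p * G.card ≤ ((G.filter fun B => x ∈ B).card : ℝ) := by
  have hint : ∀ B ∈ G, IntegrableOn (B.indicator (fun _ => (1:ℝ))) (cube d) := by
    intro B hB
    apply IntegrableOn.indicator _ (hG B hB).1.meas
    exact integrableOn_const (by simp [volume_cube])
  obtain ⟨x, hx, h⟩ := exists_setAverage_le (μ := volume) (s := cube d)
    (f := fun x => ∑ B ∈ G, B.indicator (fun _ => (1:ℝ)) x)
    (by simp [volume_cube]) (by simp [volume_cube]) (integrable_finsetSum _ hint)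
  refine ⟨x, hx, ?_⟩
  have e1 : ∑ B ∈ G, B.indicator (fun _ => (1:ℝ)) x = ((G.filter fun B => x ∈ B).card : ℝ) := by
    simp [Set.indicator_apply, Finset.sum_boole]
  rw [← e1]
  refine le_trans ?_ h
  rw [setAverage_eq, integral_finsetSum _ hint]
  simp only [measureReal_def, volume_cube, ENNReal.toReal_one, inv_one, one_smul]
  have : ∀ B ∈ G, p ≤ ∫ a in cube d, B.indicator (fun _ => (1:ℝ)) a := by
    intro B hB
    rw [integral_indicator_const _ (hG B hB).1.meas, measureReal_restrict_apply (hG B hB).1.meas,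
      Set.inter_eq_left.2 (hG B hB).1.sub]
    simpa [measureReal_def] using (hG B hB).2
  calc p * G.card = ∑ B ∈ G, p := by simp [mul_comm]
    _ ≤ _ := Finset.sum_le_sum this

open Classical in
lemma greedy {d : ℕ} (p : ℝ) (hp : p ≤ 1) (G : Finset (Set (Fin d → ℝ)))
    (hG : ∀ B ∈ G, IsPerBox B ∧ p ≤ (volume B).toReal) (k : ℕ) :
    ∃ P : Finset (Fin d → ℝ), (P : Set (Fin d → ℝ)) ⊆ cube d ∧ P.card ≤ k ∧
      ((G.filter fun B => B ∩ (P : Set (Fin d → ℝ)) = ∅).card : ℝ) ≤ (1 - p) ^ k * G.card := by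
  induction k with
  | zero => exact ⟨∅, by simp, by simp, by simp⟩
  | succ k ih =>
    obtain ⟨P, hP, hc, hk⟩ := ih
    set G' := G.filter fun B => B ∩ (P : Set (Fin d → ℝ)) = ∅ with hG'
    obtain ⟨x, hx, h⟩ := exists_pt p G' (fun B hB => hG B (Finset.mem_filter.1 hB).1)
    refine ⟨insert x P, ?_, (Finset.card_insert_le _ _).trans (by omega), ?_⟩
    · rw [Finset.coe_insert]; exact Set.insert_subset hx hP
    · have hsub : (G.filter fun B => B ∩ ((insert x P : Finset _) : Set (Fin d → ℝ)) = ∅) ⊆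
          G'.filter fun B => ¬ x ∈ B := by
        intro B hB
        rw [Finset.mem_filter] at hB
        rw [Finset.mem_filter, hG', Finset.mem_filter]
        have h2 := Set.eq_empty_iff_forall_notMem.1 hB.2
        refine ⟨⟨hB.1, Set.eq_empty_iff_forall_notMem.2 fun y hy => h2 y ⟨hy.1, ?_⟩⟩,
          fun hxB => h2 x ⟨hxB, by simp⟩⟩
        rw [Finset.coe_insert]; exact Or.inr hy.2
      have h3 : ((G.filter fun B => B ∩ ((insert x P : Finset _) : Set (Fin d → ℝ)) = ∅).card : ℝ)
          ≤ ((G'.filter fun B => ¬ x ∈ B).card : ℝ) := by exact_mod_cast Finset.card_le_card hsub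
      have h4 : ((G'.filter fun B => x ∈ B).card : ℝ) + ((G'.filter fun B => ¬ x ∈ B).card : ℝ)
          = G'.card := by exact_mod_cast Finset.card_filter_add_card_filter_not (s := G') _
      have h5 := mul_le_mul_of_nonneg_left hk (sub_nonneg.2 hp)
      rw [pow_succ]
      nlinarith

lemma pdisp_nonneg {d : ℕ} (P : Set (Fin d → ℝ)) : 0 ≤ pdisp P := by
  apply Real.sSup_nonneg
  rintro v ⟨B, -, -, rfl⟩
  exact ENNReal.toReal_nonneg

/-- If `Ñ` is a `δ`-net for `B̃_{ε,d}` with `|Ñ| ≥ 3`, then `Ñ(ε,d) ≤ 3 ln|Ñ| / ((1-δ)ε)`. -/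
theorem pNinv_le_of_perDeltaNet (d : ℕ) (hd : 1 ≤ d) (ε δ : ℝ)
    (hε0 : 0 < ε) (hε1 : ε < 1) (hδ0 : 0 < δ) (hδ1 : δ < 1)
    (F : Finset (Set (Fin d → ℝ))) (hF : IsPerDeltaNet δ ε d F) (hcard : 3 ≤ F.card) :
    (pNinv ε d : ℝ) ≤ 3 * Real.log F.card / ((1 - δ) * ε) := by
  classical
  have hp0 : 0 < (1 - δ) * ε := mul_pos (by linarith) hε0
  have hp1 : (1 - δ) * ε < 1 := by nlinarith
  set p := (1 - δ) * ε with hp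
  have hcR : (3:ℝ) ≤ F.card := by exact_mod_cast hcard
  have hlog : 1 ≤ Real.log F.card := by
    rw [Real.le_log_iff_exp_le (by linarith)]
    linarith [Real.exp_one_lt_d9]
  set L := Real.log F.card with hL
  set n := ⌈L / p⌉₊ with hn
  have hn1 : L / p ≤ n := Nat.le_ceil _
  have hn2 : (n:ℝ) < L / p + 1 := Nat.ceil_lt_add_one (by positivity)
  have hLp : L ≤ n * p := (div_le_iff₀ hp0).1 hn1
  have hnpos : n ≠ 0 := by
    rintro h
    rw [h] at hLp
    norm_num at hLp
    linarith
  have hone : 1 ≤ L / p := by rw [le_div_iff₀ hp0]; linarith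
  set G := F.filter fun B => p ≤ (volume B).toReal with hG
  obtain ⟨P, hPc, hPn, hPG⟩ := greedy p hp1.le G
    (fun B hB => ⟨hF.1 B (Finset.mem_filter.1 hB).1, (Finset.mem_filter.1 hB).2⟩) n
  have hGF : (G.card : ℝ) ≤ F.card := by exact_mod_cast Finset.card_filter_le _ _
  have hlt : (1 - p) ^ n * F.card < 1 := by
    have h1 : (1 - p) ^ n < Real.exp (-p) ^ n := by
      apply pow_lt_pow_left₀ _ (by linarith) hnpos
      have := Real.add_one_lt_exp (x := -p) (by linarith)
      linarith
    have h2 : Real.exp (-p) ^ n ≤ Real.exp (-L) := by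
      rw [← Real.exp_nat_mul]
      apply Real.exp_le_exp.2; linarith
    have h3 : Real.exp (-L) * F.card = 1 := by
      rw [Real.exp_neg, hL, Real.exp_log (by linarith)]
      exact inv_mul_cancel₀ (by linarith)
    exact (mul_lt_mul_of_pos_right (h1.trans_le h2) (by linarith)).trans_eq h3
  have hemp : (G.filter fun B => B ∩ (P : Set (Fin d → ℝ)) = ∅) = ∅ := by
    rw [← Finset.card_eq_zero]
    have h1 : (1 - p) ^ n * (G.card : ℝ) ≤ (1 - p) ^ n * F.card :=
      mul_le_mul_of_nonneg_left hGF (pow_nonneg (by linarith) _)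
    have h2 := (hPG.trans h1).trans_lt hlt
    have h3 : (G.filter fun B => B ∩ (P : Set (Fin d → ℝ)) = ∅).card < 1 := by exact_mod_cast h2
    omega
  have hdisp : pdisp (P : Set (Fin d → ℝ)) ≤ ε := by
    apply Real.sSup_le _ hε0.le
    rintro v ⟨B, hB, hBP, rfl⟩
    by_contra! hv
    obtain ⟨B₀, hB₀, hsub, hvol⟩ := hF.2 B hB hv.le
    have : B₀ ∈ (G.filter fun B => B ∩ (P : Set (Fin d → ℝ)) = ∅) := by
      rw [Finset.mem_filter, hG, Finset.mem_filter]
      refine ⟨⟨hB₀, le_trans ?_ hvol⟩, ?_⟩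
      · exact mul_le_mul_of_nonneg_left hv.le (by linarith)
      · exact Set.subset_eq_empty (Set.inter_subset_inter_left _ hsub) hBP
    rw [hemp] at this
    simp at this
  have hmin : pminDisp P.card d ≤ ε := by
    refine le_trans (csInf_le ⟨0, ?_⟩ ⟨P, hPc, rfl, rfl⟩) hdisp
    rintro v ⟨Q, -, -, rfl⟩
    exact pdisp_nonneg _
  have hN : pNinv ε d ≤ n := (Nat.sInf_le hmin).trans hPn
  have hNR : (pNinv ε d : ℝ) ≤ n := by exact_mod_cast hN
  rw [mul_div_assoc]
  linarith
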